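/- arXiv:2107.01154 — 3 statements merged into one kernel-verified Lean document; each statement's English description precedes it below -/
import Mathlib

section
/- Let X be a type of client data, n a positive integer, and R, R' measurable spaces. For datasets D, D' : Fin n → X say they are i-adjacent if D j = D' j for all j ≠ i. Let M assign to each dataset D a probability measure M(D) on R, and suppose M is (ε,δ)-differentially private: for every i and every pair of i-adjacent datasets D, D', and every measurable B ⊆ R, M(D)(B) ≤ e^ε · M(D')(B) + δ. For each agent j ∈ Fin n let f j : X → R → R' be such that f j x is measurable for every x ∈ X. Then the composed mechanism is (ε,δ)-joint differentially private: for every agent i, every pair of i-adjacent datasets D, D', and every measurable subset B of the product space ({j : Fin n // j ≠ i} → R') of the other agents' outputs, the pushforward of M(D) under the map r ↦ (fun j ↦ f j (D j) r) assigns to B at most e^ε times the measure that the pushforward of M(D') under the map r ↦ (fun j ↦ f j (D' j) r) assigns to B, plus δ. -/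
open MeasureTheory

/-- Billboard Lemma (Lemma 2): if the mechanism M is (ε,δ)-differentially
private and each agent j post-processes the public output with a measurable
function f j of its own data, then the joint outputs delivered to all agents
other than i satisfy the (ε,δ)-indistinguishability condition on datasets
differing only in agent i's data, i.e. the composition is (ε,δ)-joint
differentially private. -/
theorem billboard_lemma {X R R' : Type*} [MeasurableSpace R] [MeasurableSpace R']
    (n : ℕ) (hn : 0 < n)
    (M : (Fin n → X) → Measure R)
    (hM : ∀ D, IsProbabilityMeasure (M D))
    (ε δ : ℝ) (hδ : 0 ≤ δ)
    (hdp : ∀ i : Fin n, ∀ D D' : Fin n → X, (∀ j : Fin n, j ≠ i → D j = D' j) →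
      ∀ B : Set R, MeasurableSet B →
        M D B ≤ ENNReal.ofReal (Real.exp ε) * M D' B + ENNReal.ofReal δ)
    (f : Fin n → X → R → R')
    (hf : ∀ (j : Fin n) (x : X), Measurable (f j x)) :
    ∀ i : Fin n, ∀ D D' : Fin n → X, (∀ j : Fin n, j ≠ i → D j = D' j) →
      ∀ B : Set ({j : Fin n // j ≠ i} → R'), MeasurableSet B →
        (M D).map (fun r => fun j : {j : Fin n // j ≠ i} => f j (D j) r) B
          ≤ ENNReal.ofReal (Real.exp ε) *
              (M D').map (fun r => fun j : {j : Fin n // j ≠ i} => f j (D' j) r) B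
            + ENNReal.ofReal δ := by
  intro i D D' hDD' B hB
  have hmeas : Measurable (fun r => fun j : {j : Fin n // j ≠ i} => f j (D' j) r) :=
    measurable_pi_lambda _ fun j => hf j (D' j)
  have heq : (fun r => fun j : {j : Fin n // j ≠ i} => f j (D j) r) =
      fun r => fun j : {j : Fin n // j ≠ i} => f j (D' j) r := by
    funext r j
    rw [hDD' j j.2]
  rw [heq, Measure.map_apply hmeas hB, Measure.map_apply hmeas hB]
  exact hdp i D D' hDD' _ (hmeas hB)
end

section
/- Let 0 < ε < 1, 0 < δ < 1, S > 0, and let v > 0 satisfy v > 2·log(1.25/δ)·S^2 / ε^2. Then for all real numbers a, b with |a − b| ≤ S and every measurable set B ⊆ ℝ, the Gaussian measures with variance v satisfy N(a, v)(B) ≤ e^ε · N(b, v)(B) + δ, where N(m, v) denotes the Gaussian probability measure on ℝ with mean m and variance v. -/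
open MeasureTheory ProbabilityTheory

lemma one_sub_exp_neg_le_exp_mul_div {l : ℝ} (hl : 0 ≤ l) (u : ℝ) :
    1 - Real.exp (-u) ≤ Real.exp (l * u) / (1 + l) := by
  rw [le_div_iff₀ (by linarith)]
  have h1 := Real.add_one_le_exp (l * u)
  rcases le_total u 1 with hu | hu
  · have h2 := Real.add_one_le_exp (-u)
    nlinarith
  · have h2 := Real.exp_pos (-u)
    nlinarith

/-- Comparison of two Gaussian densities up to an error that is a multiple of the density tilted
by the `l`-th power of their ratio. -/
lemma gaussianPDFReal_le_exp_mul_add (a b ε : ℝ) {l : ℝ} (hl : 0 ≤ l) {v : NNReal} (hv : v ≠ 0)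
    (x : ℝ) :
    gaussianPDFReal a v x ≤ Real.exp ε * gaussianPDFReal b v x +
      Real.exp ((l + l ^ 2) * (a - b) ^ 2 / (2 * v) - l * ε) / (1 + l) *
        gaussianPDFReal (a + l * (a - b)) v x := by
  have hv' : (v : ℝ) ≠ 0 := by exact_mod_cast hv
  set u : ℝ := ((x - b) ^ 2 - (x - a) ^ 2) / (2 * v) - ε with hu
  have hb : Real.exp ε * gaussianPDFReal b v x = gaussianPDFReal a v x * Real.exp (-u) := by
    simp only [gaussianPDFReal]
    rw [mul_left_comm, mul_assoc _ (Real.exp _), ← Real.exp_add, ← Real.exp_add]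
    congr 2
    rw [hu]
    field_simp
    ring
  have hm : Real.exp ((l + l ^ 2) * (a - b) ^ 2 / (2 * v) - l * ε) *
      gaussianPDFReal (a + l * (a - b)) v x = gaussianPDFReal a v x * Real.exp (l * u) := by
    simp only [gaussianPDFReal]
    rw [mul_left_comm, mul_assoc _ (Real.exp _), ← Real.exp_add, ← Real.exp_add]
    congr 2
    rw [hu]
    field_simp
    ring
  rw [hb, div_mul_eq_mul_div, hm, mul_div_assoc, ← mul_add]
  refine le_mul_of_one_le_right (gaussianPDFReal_nonneg a v x) ?_
  linarith [one_sub_exp_neg_le_exp_mul_div hl u]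

lemma gaussianReal_le_exp_mul_add (a b ε : ℝ) {l : ℝ} (hl : 0 ≤ l) {v : NNReal} (hv : v ≠ 0)
    (B : Set ℝ) :
    gaussianReal a v B ≤ ENNReal.ofReal (Real.exp ε) * gaussianReal b v B +
      ENNReal.ofReal
        (Real.exp ((l + l ^ 2) * (a - b) ^ 2 / (2 * v) - l * ε) / (1 + l)) := by
  set C : ℝ := Real.exp ((l + l ^ 2) * (a - b) ^ 2 / (2 * v) - l * ε) / (1 + l) with hC
  have hC0 : 0 ≤ C := by positivity
  calc gaussianReal a v B
      = ∫⁻ x in B, gaussianPDF a v x := gaussianReal_apply a hv B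
    _ ≤ ∫⁻ x in B, (ENNReal.ofReal (Real.exp ε) * gaussianPDF b v x +
          ENNReal.ofReal C * gaussianPDF (a + l * (a - b)) v x) := by
        refine lintegral_mono fun x => ?_
        simp only [gaussianPDF]
        rw [← ENNReal.ofReal_mul (Real.exp_nonneg _), ← ENNReal.ofReal_mul hC0,
          ← ENNReal.ofReal_add
            (mul_nonneg (Real.exp_nonneg _) (gaussianPDFReal_nonneg _ _ _))
            (mul_nonneg hC0 (gaussianPDFReal_nonneg _ _ _))]
        exact ENNReal.ofReal_le_ofReal (gaussianPDFReal_le_exp_mul_add a b ε hl hv x)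
    _ = ENNReal.ofReal (Real.exp ε) * gaussianReal b v B +
          ENNReal.ofReal C * gaussianReal (a + l * (a - b)) v B := by
        rw [lintegral_add_left ((measurable_gaussianPDF b v).const_mul _),
          lintegral_const_mul _ (measurable_gaussianPDF b v),
          lintegral_const_mul _ (measurable_gaussianPDF _ v),
          gaussianReal_apply b hv, gaussianReal_apply _ hv]
    _ ≤ ENNReal.ofReal (Real.exp ε) * gaussianReal b v B + ENNReal.ofReal C := by
        gcongr
        exact mul_le_of_le_one_right' prob_le_one

/-- Gaussian mechanism (Definition 2, Dwork–Roth): Gaussian measures with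
common variance v > 2·log(1.25/δ)·S²/ε² and means differing by at most S
satisfy the (ε,δ)-indistinguishability condition. -/
theorem gaussian_mechanism (ε δ S : ℝ) (hε0 : 0 < ε) (hε1 : ε < 1)
    (hδ0 : 0 < δ) (hδ1 : δ < 1) (hS : 0 < S)
    (v : NNReal) (hv0 : 0 < v)
    (hv : (v : ℝ) > 2 * Real.log (1.25 / δ) * S ^ 2 / ε ^ 2) :
    ∀ a b : ℝ, |a - b| ≤ S → ∀ B : Set ℝ, MeasurableSet B →
      gaussianReal a v B ≤
        ENNReal.ofReal (Real.exp ε) * gaussianReal b v B + ENNReal.ofReal δ := by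
  intro a b hab B _
  have hvpos : (0 : ℝ) < v := by exact_mod_cast hv0
  obtain ⟨l, hl⟩ : ∃ l : ℝ, l = ε * v / S ^ 2 := ⟨_, rfl⟩
  have hl0 : 0 < l := by rw [hl]; positivity
  have hlog : 2 * Real.log (1.25 / δ) < ε * l := by
    rw [gt_iff_lt, div_lt_iff₀ (by positivity)] at hv
    rw [hl, ← mul_div_assoc, lt_div_iff₀ (by positivity)]
    linarith
  have hl4 : 0.4 ≤ l := by
    have h1 : 1 - (1.25 / δ)⁻¹ ≤ Real.log (1.25 / δ) :=
      Real.one_sub_inv_le_log_of_pos (by positivity)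
    rw [inv_div] at h1
    have h2 : δ / 1.25 ≤ 0.8 := by rw [div_le_iff₀ (by norm_num)]; linarith
    nlinarith
  refine (gaussianReal_le_exp_mul_add a b ε hl0.le hv0.ne' B).trans ?_
  gcongr
  have hsq : (a - b) ^ 2 ≤ S ^ 2 := sq_le_sq' (abs_le.mp hab).1 (abs_le.mp hab).2
  have hexp : (l + l ^ 2) * (a - b) ^ 2 / (2 * v) - l * ε ≤
      1 / 2 + -Real.log (1.25 / δ) := by
    have h1 : (l + l ^ 2) * (a - b) ^ 2 / (2 * v) ≤ (l + l ^ 2) * S ^ 2 / (2 * v) := by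
      gcongr
    have h2 : (l + l ^ 2) * S ^ 2 / (2 * v) = (1 + l) * ε / 2 := by
      have h3 : l * S ^ 2 = ε * v := by rw [hl]; field_simp
      rw [div_eq_div_iff (by positivity) (by norm_num)]
      linear_combination 2 * (1 + l) * h3
    linarith
  have hhalf : Real.exp (1 / 2) ≤ 1.75 := by
    have h1 : Real.exp (1 / 2) * Real.exp (1 / 2) = Real.exp 1 := by
      rw [← Real.exp_add]; norm_num
    nlinarith [Real.exp_one_lt_d9, Real.exp_pos (1 / 2)]
  rw [div_le_iff₀ (by linarith)]
  calc _ ≤ Real.exp (1 / 2 + -Real.log (1.25 / δ)) := Real.exp_le_exp.mpr hexp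
    _ = Real.exp (1 / 2) * (δ / 1.25) := by
      rw [Real.exp_add, Real.exp_neg, Real.exp_log (by positivity), inv_div]
    _ ≤ 1.75 * (δ / 1.25) := by gcongr
    _ = δ * 1.4 := by ring
    _ ≤ δ * (1 + l) := by gcongr; linarith
end

section
/- Let ε ≥ 0, δ ≥ 0, q ∈ [0, 1], and let a, b ≥ 0 be real numbers with a ≤ e^ε · b + δ. Then (1 − q)·b + q·a ≤ e^{log(1 + q·(e^ε − 1))} · b + q·δ; that is, the q-mixture (1 − q)·b + q·a is bounded by e^{ε'} · b + q·δ with the amplified privacy parameter ε' = log(1 + q·(e^ε − 1)) ≤ ε. -/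
/-- Privacy amplification by subsampling (Definition 3): the q-mixture of a
mass a that is (ε,δ)-close to a baseline mass b with the baseline itself
satisfies the indistinguishability condition with the amplified parameters
(log(1 + q(e^ε − 1)), q·δ), and the amplified ε is at most ε. -/
theorem privacy_amplification_by_subsampling (ε δ q a b : ℝ)
    (hε : 0 ≤ ε) (hδ : 0 ≤ δ) (hq0 : 0 ≤ q) (hq1 : q ≤ 1)
    (ha : 0 ≤ a) (hb : 0 ≤ b)
    (h : a ≤ Real.exp ε * b + δ) :
    (1 - q) * b + q * a ≤
        Real.exp (Real.log (1 + q * (Real.exp ε - 1))) * b + q * δ ∧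
      Real.log (1 + q * (Real.exp ε - 1)) ≤ ε := by
  have hexp : 0 ≤ Real.exp ε - 1 := sub_nonneg.mpr (Real.one_le_exp hε)
  have hpos : 0 < 1 + q * (Real.exp ε - 1) := by positivity
  constructor
  · rw [Real.exp_log hpos]
    linarith [mul_le_mul_of_nonneg_left h hq0]
  · rw [Real.log_le_iff_le_exp hpos]
    linarith [mul_le_of_le_one_left hexp hq1]
end
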